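/- arXiv:math/0006001 — 9 statements merged into one kernel-verified Lean document; each statement's English description precedes it below -/
import Mathlib

section
/- Let R be a commutative ring and α ∈ R. For t ∈ R define the antitriangle supermatrix P(t) = !![0, α*t; α, 1] in Matrix (Fin 2) (Fin 2) R. Then the family {P(t)} is a left-zero band, i.e. P(t) * P(s) = P(t) for all t, s ∈ R, if and only if α² = 0. -/
theorem stmt_0 (R : Type*) [CommRing R] (α : R) :
    (∀ t s : R,
      (!![0, α * t; α, 1] : Matrix (Fin 2) (Fin 2) R) * !![0, α * s; α, 1] =
        !![0, α * t; α, 1]) ↔ α ^ 2 = 0 := by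
  constructor
  · intro h
    have h00 := congrFun (congrFun (h 1 0) 0) 0
    simpa [Matrix.mul_apply, Fin.sum_univ_two, ← sq] using h00
  · intro h t s
    have h₁ : α * t * α = 0 := by linear_combination t * h
    have h₂ : α * (α * s) = 0 := by linear_combination s * h
    simp [h₁, h₂]
end

section
/- Let R be a commutative ring and α ∈ R with α² = 0. Then the families P and Q are rectangular bands: for all t, s ∈ R, P(t) * P(s) * P(t) = P(t), P(s) * P(t) * P(s) = P(s), Q(s) * Q(t) * Q(s) = Q(s), and Q(t) * Q(s) * Q(t) = Q(t). -/
theorem oddReduced_mul_oddReduced {R : Type*} [CommRing R] {α : R} (hα : α ^ 2 = 0)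
    (a b c d : R) :
    !![0, α * a; α * b, 1] * !![0, α * c; α * d, 1] = !![0, α * a; α * d, 1] := by
  have hmul (x y : R) : α * x * (α * y) = 0 := by
    linear_combination x * y * hα
  simp [hmul]

theorem stmt_2 (R : Type*) [CommRing R] (α : R) (hα : α ^ 2 = 0)
    (P Q : R → Matrix (Fin 2) (Fin 2) R)
    (hP : ∀ t, P t = !![0, α * t; α, 1])
    (hQ : ∀ t, Q t = !![0, α; α * t, 1]) :
    ∀ t s : R,
      P t * P s * P t = P t ∧
      P s * P t * P s = P s ∧
      Q s * Q t * Q s = Q s ∧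
      Q t * Q s * Q t = Q t := by
  have hPP (t s : R) : P t * P s = P t := by
    simpa [hP] using oddReduced_mul_oddReduced hα t 1 s 1
  have hQQ (t s : R) : Q t * Q s = Q s := by
    simpa [hQ] using oddReduced_mul_oddReduced hα 1 t 1 s
  intro t s
  simp only [hPP, hQQ, and_self]
end

section
/- Let R be a commutative ring and α ∈ R with α² = 0. Then for all t, s ∈ R: Q(s) * P(t) = E (orthogonality); moreover E is a right unity and left zero of the P-family and a left unity and right zero of the Q-family, i.e. P(t) * E = P(t), E * P(t) = E, Q(t) * E = E, and E * Q(t) = Q(t). -/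
theorem stmt_3 (R : Type*) [CommRing R] (α : R) (hα : α ^ 2 = 0)
    (P Q : R → Matrix (Fin 2) (Fin 2) R) (E : Matrix (Fin 2) (Fin 2) R)
    (hP : ∀ t, P t = !![0, α * t; α, 1])
    (hQ : ∀ t, Q t = !![0, α; α * t, 1])
    (hE : E = !![0, α; α, 1]) :
    ∀ t s : R,
      Q s * P t = E ∧
      P t * E = P t ∧ E * P t = E ∧
      Q t * E = E ∧ E * Q t = Q t := by
  intro t s
  have h : α * α = 0 := by rw [← sq, hα]
  have h_left (x : R) : α * x * α = 0 := by rw [mul_right_comm, h, zero_mul]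
  have h_right (x : R) : α * (α * x) = 0 := by rw [← mul_assoc, h, zero_mul]
  have h_both (x y : R) : α * x * (α * y) = 0 := by rw [← mul_assoc, h_left, zero_mul]
  simp [hP, hQ, hE, h, h_left, h_right, h_both]
end

section
/- Let R be a commutative ring and α ∈ R with α² = 0. Then for every t ∈ R and every natural number n: T(t)^n * P(t) = P((n + 1) * t), and for every n ≥ 1, P(t)^n * T(t) = P(t). (A superoperator standing on the left transfers its type to the product.) -/
theorem stmt_6 (R : Type*) [CommRing R] (α : R) (hα : α ^ 2 = 0)
    (P T : R → Matrix (Fin 2) (Fin 2) R)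
    (hP : ∀ t, P t = !![0, α * t; α, 1])
    (hT : ∀ t, T t = !![1, α * t; 0, 1]) :
    (∀ (t : R) (n : ℕ), T t ^ n * P t = P (((n : R) + 1) * t)) ∧
    (∀ (t : R) (n : ℕ), 1 ≤ n → P t ^ n * T t = P t) := by
  have T_mul_P (t s : R) : T t * P s = P (s + t) := by
    rw [hT, hP, hP, Matrix.mul_fin_two]
    congr! 3 <;> grind
  have P_mul_T (t : R) : P t * T t = P t := by
    rw [hT, hP, Matrix.mul_fin_two]
    congr! 3 <;> grind
  have P_idem (t : R) : IsIdempotentElem (P t) := by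
    rw [IsIdempotentElem, hP, Matrix.mul_fin_two]
    congr! 3 <;> grind
  refine ⟨fun t n => ?_, fun t n hn => ?_⟩
  · induction n with
    | zero => simp
    | succ n ih =>
      rw [pow_succ', mul_assoc, ih, T_mul_P]
      congr 1
      push_cast
      ring
  · rw [(P_idem t).pow_eq (by lia), P_mul_T]
end

section
/- Let R be a commutative ring and α ∈ R with α² = 0. Then the commutator of the exponential and idempotent supermatrices is nonvanishing and proportional to the generator: T(t) * P(s) - P(s) * T(t) = t • A for all t, s ∈ R; and the idempotent commutator satisfies P(t) * P(s) - P(s) * P(t) = (t - s) • A for all t, s ∈ R. -/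
theorem stmt_7 (R : Type*) [CommRing R] (α : R) (hα : α ^ 2 = 0)
    (P T : R → Matrix (Fin 2) (Fin 2) R) (A : Matrix (Fin 2) (Fin 2) R)
    (hP : ∀ t, P t = !![0, α * t; α, 1])
    (hT : ∀ t, T t = !![1, α * t; 0, 1])
    (hA : A = !![0, α; 0, 0]) :
    (∀ t s : R, T t * P s - P s * T t = t • A) ∧
    (∀ t s : R, P t * P s - P s * P t = (t - s) • A) := by
  subst hA
  constructor <;> intro t s <;> simp only [hP, hT] <;> ext i j <;> fin_cases i <;> fin_cases j <;>
    simp <;> grind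
end

section
/- Let R be a commutative ring and α ∈ R with α² = 0. For a unit z ∈ Rˣ define the resolvent of the idempotent superoperator R_P(z) = !![0, α * z⁻¹ * z⁻¹; α * z⁻¹, z⁻¹] ∈ Matrix (Fin 2) (Fin 2) R. Then R_P satisfies the generalized resolvent relation with an additional term proportional to the generator A = !![0, α; 0, 0]: for all units z, w ∈ Rˣ, R_P(z) - R_P(w) = (w - z) • (R_P(z) * R_P(w)) + ((w - z) * z⁻¹ * w⁻¹ * w⁻¹) • A. -/
theorem stmt_13 (R : Type*) [CommRing R] (α : R) (hα : α ^ 2 = 0)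
    (RP : Rˣ → Matrix (Fin 2) (Fin 2) R) (A : Matrix (Fin 2) (Fin 2) R)
    (hRP : ∀ z : Rˣ, RP z = !![0, α * ↑z⁻¹ * ↑z⁻¹; α * ↑z⁻¹, (↑z⁻¹ : R)])
    (hA : A = !![0, α; 0, 0]) :
    ∀ z w : Rˣ,
      RP z - RP w =
        ((↑w : R) - ↑z) • (RP z * RP w) +
          (((↑w : R) - ↑z) * ↑z⁻¹ * ↑w⁻¹ * ↑w⁻¹) • A := by
  intro z w
  have hαα : α * α = 0 := by rw [← sq, hα]
  have key : ((w : R) - z) * (↑z⁻¹ * ↑w⁻¹) = ↑z⁻¹ - ↑w⁻¹ := by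
    linear_combination (↑z⁻¹ : R) * w.mul_inv - (↑w⁻¹ : R) * z.mul_inv
  rw [hRP z, hRP w, hA]
  generalize (↑z⁻¹ : R) = a at key ⊢
  generalize (↑w⁻¹ : R) = b at key ⊢
  ext i j
  fin_cases i <;> fin_cases j <;> simp
  · linear_combination (-((w : R) - z) * a * a * b) * hαα
  · linear_combination (-α * (a + b)) * key
  · linear_combination (-α) * key
  · linear_combination (-((w : R) - z) * a * b * b) * hαα - key
end

section
/- Let A be an associative algebra over ℝ, n a natural number, and K₀, …, Kₙ ∈ A. Define the t-power-type operator K(t) = Σ_{m=0}^{n} t^m • Kₘ for t ∈ ℝ. If K satisfies the band equation K(t) * K(s) = K(t) for all t, s ∈ ℝ, then K satisfies the n-generalized functional equation: for all t, s ∈ ℝ, K(t + s) = K(t) * K(s) + Σ_{m=1}^{n} Σ_{l=m}^{n} ((Nat.choose l m : ℝ) * s^m * t^(l-m)) • K_l. -/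
/-- The binomial theorem with the `m = 0` term split off. -/
lemma add_pow_eq_pow_add_sum_Icc {R : Type*} [CommSemiring R] (t s : R) (l : ℕ) :
    (t + s) ^ l = t ^ l + ∑ m ∈ Finset.Icc 1 l, (Nat.choose l m : R) * s ^ m * t ^ (l - m) := by
  rw [add_comm t s, add_pow, Finset.range_eq_Ico,
    Finset.sum_eq_sum_Ico_succ_bot (Nat.succ_pos l)]
  congr 1
  · simp
  · refine Finset.sum_congr (by ext; grind) fun m _ => ?_
    ring

theorem stmt_15 (A : Type*) [Ring A] [Algebra ℝ A] (n : ℕ) (K : ℕ → A)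
    (hband : ∀ t s : ℝ,
      (∑ m ∈ Finset.range (n + 1), t ^ m • K m) *
        (∑ m ∈ Finset.range (n + 1), s ^ m • K m) =
        ∑ m ∈ Finset.range (n + 1), t ^ m • K m) :
    ∀ t s : ℝ,
      (∑ m ∈ Finset.range (n + 1), (t + s) ^ m • K m) =
        (∑ m ∈ Finset.range (n + 1), t ^ m • K m) *
          (∑ m ∈ Finset.range (n + 1), s ^ m • K m) +
          ∑ m ∈ Finset.Icc 1 n, ∑ l ∈ Finset.Icc m n,
            ((Nat.choose l m : ℝ) * s ^ m * t ^ (l - m)) • K l := by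
  intro t s
  have hswap : ∑ m ∈ Finset.Icc 1 n, ∑ l ∈ Finset.Icc m n,
      ((Nat.choose l m : ℝ) * s ^ m * t ^ (l - m)) • K l =
      ∑ l ∈ Finset.range (n + 1), ∑ m ∈ Finset.Icc 1 l,
        ((Nat.choose l m : ℝ) * s ^ m * t ^ (l - m)) • K l :=
    Finset.sum_comm' fun m l => by
      simp only [Finset.mem_Icc, Finset.mem_range]
      omega
  rw [hband, hswap, ← Finset.sum_add_distrib]
  refine Finset.sum_congr rfl fun l _ => ?_
  rw [add_pow_eq_pow_add_sum_Icc, add_smul, Finset.sum_smul]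
end

section
/- Let A be an associative algebra over ℝ and K₀, K₁ ∈ A, and define the t-linear operator K(t) = K₀ + t • K₁ for t ∈ ℝ. Then the following three statements are equivalent: (1) K is idempotent and satisfies the band equation K(t) * K(s) = K(t) for all t, s ∈ ℝ; (2) K satisfies the generalized functional equation K(t + s) = K(t) * K(s) + s • K₁ for all t, s ∈ ℝ; (3) K satisfies the differential-equation condition K₁ * K(t) = K₁ for all t ∈ ℝ, its time-independent part is idempotent, K₀ * K₀ = K₀, and K₀ is orthogonal to the generator, K₀ * K₁ = 0. -/
theorem stmt_18 (A : Type*) [Ring A] [Algebra ℝ A] (K₀ K₁ : A) :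
    List.TFAE [
      (∀ t : ℝ, (K₀ + t • K₁) * (K₀ + t • K₁) = K₀ + t • K₁) ∧
        (∀ t s : ℝ, (K₀ + t • K₁) * (K₀ + s • K₁) = K₀ + t • K₁),
      ∀ t s : ℝ, K₀ + (t + s) • K₁ = (K₀ + t • K₁) * (K₀ + s • K₁) + s • K₁,
      (∀ t : ℝ, K₁ * (K₀ + t • K₁) = K₁) ∧ K₀ * K₀ = K₀ ∧ K₀ * K₁ = 0] := by
  tfae_have 1 → 2 := by
    rintro ⟨-, h⟩ t s
    rw [h t s]
    module
  tfae_have 2 → 3 := by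
    intro h
    have band (t s : ℝ) : (K₀ + t • K₁) * (K₀ + s • K₁) = K₀ + t • K₁ := by
      rw [eq_sub_of_add_eq (h t s).symm]
      module
    have absorb (s : ℝ) : K₀ * (K₀ + s • K₁) = K₀ := by simpa using band 0 s
    have idem : K₀ * K₀ = K₀ := by simpa using absorb 0
    refine ⟨fun t ↦ ?_, idem, ?_⟩
    · have := band 1 t
      rwa [one_smul, add_mul, absorb t, add_right_inj] at this
    · have := absorb 1
      rwa [one_smul, mul_add, idem, add_eq_left] at this
  tfae_have 3 → 1 := by
    rintro ⟨h, idem, orth⟩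
    have band (t s : ℝ) : (K₀ + t • K₁) * (K₀ + s • K₁) = K₀ + t • K₁ := by
      rw [add_mul, smul_mul_assoc, h s, mul_add, idem, mul_smul_comm, orth, smul_zero, add_zero]
    exact ⟨fun t ↦ band t t, band⟩
  tfae_finish
end

section
/- Let A be an associative algebra over ℝ, n a natural number, and K₀, …, Kₙ ∈ A. Define the t-power-type operator K(t) = Σ_{m=0}^{n} t^m • Kₘ for t ∈ ℝ. If K satisfies the band equation K(t) * K(s) = K(t) for all t, s ∈ ℝ, then the components satisfy the system: K₀ * K₀ = K₀; Kᵢ * Kᵢ = 0 for all 1 ≤ i ≤ n; Kᵢ * K₀ = Kᵢ for all 1 ≤ i ≤ n; K₀ * Kᵢ = 0 for all 1 ≤ i ≤ n; and Kᵢ * Kⱼ = 0 for all 1 ≤ i, j ≤ n with i ≠ j. -/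
/-- Two polynomial functions with coefficients in a vector space over an infinite field
agree only if their coefficients agree. -/
theorem eq_of_forall_sum_pow_smul_eq {k V : Type*} [Field k] [Infinite k] [AddCommGroup V]
    [Module k V] {N : ℕ} {a b : ℕ → V}
    (h : ∀ t : k, ∑ m ∈ Finset.range N, t ^ m • a m = ∑ m ∈ Finset.range N, t ^ m • b m)
    {i : ℕ} (hi : i < N) : a i = b i := by
  rw [← sub_eq_zero, ← Module.forall_dual_apply_eq_zero_iff k]
  intro φ
  have hp : ∑ m ∈ Finset.range N, Polynomial.monomial m (φ (a m)) =
      ∑ m ∈ Finset.range N, Polynomial.monomial m (φ (b m)) := by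
    refine Polynomial.funext fun t => ?_
    simpa [Polynomial.eval_finsetSum, mul_comm] using congrArg φ (h t)
  simpa [Polynomial.finsetSum_coeff, Polynomial.coeff_monomial, hi, sub_eq_zero] using
    congrArg (Polynomial.coeff · i) hp

theorem stmt_19 (A : Type*) [Ring A] [Algebra ℝ A] (n : ℕ) (K : ℕ → A)
    (hband : ∀ t s : ℝ,
      (∑ m ∈ Finset.range (n + 1), t ^ m • K m) *
        (∑ m ∈ Finset.range (n + 1), s ^ m • K m) =
        ∑ m ∈ Finset.range (n + 1), t ^ m • K m) :
    K 0 * K 0 = K 0 ∧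
    (∀ i, 1 ≤ i → i ≤ n → K i * K i = 0) ∧
    (∀ i, 1 ≤ i → i ≤ n → K i * K 0 = K i) ∧
    (∀ i, 1 ≤ i → i ≤ n → K 0 * K i = 0) ∧
    (∀ i j, 1 ≤ i → i ≤ n → 1 ≤ j → j ≤ n → i ≠ j → K i * K j = 0) := by
  have hmul : ∀ i, i ≤ n → ∀ s : ℝ,
      K i * ∑ m ∈ Finset.range (n + 1), s ^ m • K m = K i := fun i hi s =>
    eq_of_forall_sum_pow_smul_eq (k := ℝ)
      (a := fun i => K i * ∑ m ∈ Finset.range (n + 1), s ^ m • K m)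
      (fun t => by simpa only [Finset.sum_mul, smul_mul_assoc] using hband t s)
      (Nat.lt_succ_of_le hi)
  have hcoeff : ∀ i j, i ≤ n → j ≤ n → K i * K j = if j = 0 then K i else 0 :=
    fun i j hi hj => eq_of_forall_sum_pow_smul_eq (k := ℝ) (a := fun j => K i * K j)
      (b := fun j => if j = 0 then K i else 0)
      (fun s => by simpa [Finset.mul_sum] using hmul i hi s) (Nat.lt_succ_of_le hj)
  refine ⟨?_, fun i h1 hi => ?_, fun i _ hi => ?_, fun i h1 hi => ?_,
    fun i j _ hi h1 hj _ => ?_⟩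
  · simpa using hcoeff 0 0 n.zero_le n.zero_le
  · simpa [Nat.ne_of_gt h1] using hcoeff i i hi hi
  · simpa using hcoeff i 0 hi n.zero_le
  · simpa [Nat.ne_of_gt h1] using hcoeff 0 i n.zero_le hi
  · simpa [Nat.ne_of_gt h1] using hcoeff i j hi hj
end
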